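/- Let f be the (unique, if it exists) unary function symbol of weight 0 in Σ. If a ground term s is a subterm of a ground term t and |s| = |t|, then t has the form f^m(s) for some natural number m (in particular, if Σ has no unary symbol of weight 0 then t = s). -/

import Mathlib

inductive Term (σ : Type) (ar : σ → ℕ) : Type
  | mk : (g : σ) → (Fin (ar g) → Term σ ar) → Term σ ar

def Term.weight {σ : Type} {ar : σ → ℕ} (w : σ → ℕ) : Term σ ar → ℕ
  | .mk g args => w g + ∑ i, Term.weight w (args i)

def Term.count {σ : Type} {ar : σ → ℕ} [DecidableEq σ] (g : σ) : Term σ ar → ℕ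
  | .mk h args => (if h = g then 1 else 0) + ∑ i, Term.count g (args i)

def Term.depth {σ : Type} {ar : σ → ℕ} : Term σ ar → ℕ
  | .mk _ args => 1 + Finset.univ.sup fun i => Term.depth (args i)

inductive Term.Subterm {σ : Type} {ar : σ → ℕ} : Term σ ar → Term σ ar → Prop
  | refl (t : Term σ ar) : Term.Subterm t t
  | arg {s : Term σ ar} {g : σ} {args : Fin (ar g) → Term σ ar} (i : Fin (ar g)) :
      Term.Subterm s (args i) → Term.Subterm s (.mk g args)

inductive KBO {σ : Type} {ar : σ → ℕ} (w : σ → ℕ) (prec : σ → σ → Prop) :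
    Term σ ar → Term σ ar → Prop
  | of_weight {t s : Term σ ar} : Term.weight w s < Term.weight w t → KBO w prec t s
  | of_prec {g h : σ} {ts : Fin (ar g) → Term σ ar} {ss : Fin (ar h) → Term σ ar} :
      Term.weight w (Term.mk g ts) = Term.weight w (Term.mk h ss) → prec g h →
      KBO w prec (Term.mk g ts) (Term.mk h ss)
  | of_lex {g : σ} {ts ss : Fin (ar g) → Term σ ar} (i : Fin (ar g)) :
      Term.weight w (Term.mk g ts) = Term.weight w (Term.mk g ss) →
      (∀ j : Fin (ar g), j < i → ts j = ss j) →
      KBO w prec (ts i) (ss i) →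
      KBO w prec (Term.mk g ts) (Term.mk g ss)

def IsWeightFn {σ : Type} (ar w : σ → ℕ) : Prop :=
  (∀ a, ar a = 0 → 0 < w a) ∧
  ∀ f g, ar f = 1 → w f = 0 → ar g = 1 → w g = 0 → f = g

def CompatiblePrec {σ : Type} (ar w : σ → ℕ) (prec : σ → σ → Prop) : Prop :=
  ∀ f, ar f = 1 → w f = 0 → ∀ g, g ≠ f → prec f g

/-- Application of a (unary) function symbol `f` to a term. -/
def applyUnary {σ : Type} {ar : σ → ℕ} (f : σ) (t : Term σ ar) : Term σ ar :=
  Term.mk f (fun _ => t)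

theorem Term.weight_pos {σ : Type} {ar w : σ → ℕ} (hconst : ∀ a, ar a = 0 → 0 < w a)
    (t : Term σ ar) : 0 < Term.weight w t := by
  induction t with
  | mk g args ih =>
    rw [Term.weight]
    rcases Nat.eq_zero_or_pos (ar g) with h | h
    · exact Nat.add_pos_left (hconst g h) _
    · exact Nat.add_pos_right _ (Finset.sum_pos (fun i _ => ih i) ⟨⟨0, h⟩, Finset.mem_univ _⟩)

theorem Term.weight_arg_le {σ : Type} {ar : σ → ℕ} (w : σ → ℕ) {g : σ}
    (args : Fin (ar g) → Term σ ar) (i : Fin (ar g)) :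
    w g + Term.weight w (args i) ≤ Term.weight w (.mk g args) := by
  rw [Term.weight]
  exact Nat.add_le_add_left
    (Finset.single_le_sum (f := fun j => Term.weight w (args j)) (fun _ _ => Nat.zero_le _)
      (Finset.mem_univ i)) _

theorem Term.Subterm.weight_le {σ : Type} {ar : σ → ℕ} (w : σ → ℕ) {s t : Term σ ar}
    (h : Term.Subterm s t) : Term.weight w s ≤ Term.weight w t := by
  induction h with
  | refl => exact le_rfl
  | arg i _ ih => exact ih.trans (le_of_add_le_right (Term.weight_arg_le w _ i))

/-- An argument as heavy as the whole term is the only argument of a weightless head symbol. -/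
theorem Term.head_of_weight_arg_eq {σ : Type} {ar w : σ → ℕ}
    (hconst : ∀ a, ar a = 0 → 0 < w a) {g : σ} (args : Fin (ar g) → Term σ ar) (i : Fin (ar g))
    (h : Term.weight w (args i) = Term.weight w (.mk g args)) :
    ar g = 1 ∧ w g = 0 ∧ Term.mk g args = applyUnary g (args i) := by
  have hg : w g = 0 := by
    have := Term.weight_arg_le w args i
    omega
  have huniq : ∀ j, j = i := by
    intro j
    by_contra hj
    rw [Term.weight, ← Finset.add_sum_erase _ _ (Finset.mem_univ i)] at h
    have hle := Finset.single_le_sum (f := fun j => Term.weight w (args j))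
      (fun _ _ => Nat.zero_le _) (Finset.mem_erase.mpr ⟨hj, Finset.mem_univ j⟩)
    have := Term.weight_pos hconst (args j)
    omega
  refine ⟨?_, hg, ?_⟩
  · simpa using Fintype.card_eq_one_iff.mpr ⟨i, huniq⟩
  · rw [applyUnary]
    congr 1
    funext j
    rw [huniq j]

theorem subterm_equal_weight {σ : Type} [Fintype σ] (ar w : σ → ℕ)
    (hconst : ∃ c, ar c = 0) (hw : IsWeightFn ar w)
    (s t : Term σ ar) (hsub : Term.Subterm s t)
    (hwt : Term.weight w s = Term.weight w t) :
    t = s ∨ ∃ f : σ, ar f = 1 ∧ w f = 0 ∧ ∃ m : ℕ, t = (applyUnary f)^[m] s := by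
  induction hsub with
  | refl => exact Or.inl rfl
  | @arg g args i hsub ih =>
    have hle := hsub.weight_le w
    have hle' := Term.weight_arg_le w args i
    have heq : Term.weight w s = Term.weight w (args i) := by omega
    obtain ⟨har, hwg, hmk⟩ := Term.head_of_weight_arg_eq hw.1 args i (heq.symm.trans hwt)
    refine Or.inr ⟨g, har, hwg, ?_⟩
    rcases ih heq with h | ⟨f, hf, hwf, m, hm⟩
    · exact ⟨1, by rw [hmk, h, Function.iterate_one]⟩
    · obtain rfl := hw.2 f g hf hwf har hwg
      exact ⟨m + 1, by rw [hmk, Function.iterate_succ_apply', hm]⟩
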